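/- arXiv:1803.09284 — 3 statements merged into one kernel-verified Lean document; each statement's English description precedes it below -/
import Mathlib

section
/- Let n ≥ 1 be an integer and p ∈ [1,∞). Let u : ℝ^n → ℝ be a measurable function with finite Besov energy, i.e. ‖u‖_B^p = ∫_{ℝ^n×ℝ^n} |u(x) − u(x')|^p / ‖x − x'‖^{2n} dx dx' < ∞. Suppose there is a nonzero vector v₀ ∈ ℝ^n such that for every t ∈ ℝ one has u(x + t·v₀) = u(x) for Lebesgue-almost every x ∈ ℝ^n. Then u is almost everywhere equal to a constant. -/
open MeasureTheory

/-- A function on a Euclidean space with finite integral which is almost everywhere invariant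
under a nonzero translation has zero integral. -/
theorem lintegral_eq_zero_of_ae_translation_invariant {n : ℕ}
    {f : EuclideanSpace ℝ (Fin n) → ENNReal} (v : EuclideanSpace ℝ (Fin n)) (hv : v ≠ 0)
    (hinv : ∀ᵐ x ∂volume, f (x + v) = f x) (hfin : ∫⁻ x, f x < ⊤) :
    ∫⁻ x, f x = 0 := by
  let q : EuclideanSpace ℝ (Fin n) → ℤ := fun x => ⌊inner ℝ v x / ‖v‖ ^ 2⌋
  have hq : Measurable q := by fun_prop
  have hqv (x : EuclideanSpace ℝ (Fin n)) : q (x + v) = q x + 1 := by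
    have hv' : ‖v‖ ^ 2 ≠ 0 := by simpa using hv
    simp only [q, inner_add_right, real_inner_self_eq_norm_sq, add_div, div_self hv',
      Int.floor_add_one]
  have hmeas (k : ℤ) : MeasurableSet (q ⁻¹' {k}) := hq (measurableSet_singleton k)
  have hstep (k : ℤ) : ∫⁻ x in q ⁻¹' {k + 1}, f x = ∫⁻ x in q ⁻¹' {k}, f x := by
    rw [← (measurePreserving_add_right volume v).setLIntegral_comp_preimage_emb
      (measurableEmbedding_addRight v)]
    have hpre : (fun x => x + v) ⁻¹' (q ⁻¹' {k + 1}) = q ⁻¹' {k} := by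
      ext x
      simp [hqv]
    rw [hpre]
    exact lintegral_congr_ae (ae_restrict_of_ae hinv)
  have hconst (k : ℤ) : ∫⁻ x in q ⁻¹' {k}, f x = ∫⁻ x in q ⁻¹' {0}, f x := by
    induction k using Int.induction_on with
    | zero => rfl
    | succ i ih => rw [hstep, ih]
    | pred i ih => rw [← ih, ← hstep, sub_add_cancel]
  have hsum : ∫⁻ x, f x = ∑' _ : ℤ, ∫⁻ x in q ⁻¹' {0}, f x := by
    have hunion : ⋃ k : ℤ, q ⁻¹' {k} = Set.univ := by
      ext x
      simp
    rw [← setLIntegral_univ, ← hunion, lintegral_iUnion hmeas]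
    · exact tsum_congr hconst
    · intro i j hij
      exact Disjoint.preimage q (by simpa using hij)
  by_cases h0 : ∫⁻ x in q ⁻¹' {0}, f x = 0
  · simp [hsum, h0]
  · rw [hsum, ENNReal.tsum_const_eq_top_of_ne_zero h0] at hfin
    exact absurd hfin (lt_irrefl _)

/-- Let `n ≥ 1`, `p ∈ [1,∞)` and let `u : ℝ^n → ℝ` be measurable with finite
Besov energy `∫∫ |u(x) − u(x')|^p / ‖x − x'‖^{2n} dx dx' < ∞`.  If there is a nonzero vector
`v₀` such that for every `t ∈ ℝ` one has `u(x + t·v₀) = u(x)` for a.e. `x`, then `u` is a.e.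
constant. -/
theorem stmt0 (n : ℕ) (hn : 1 ≤ n) (p : ℝ) (hp : 1 ≤ p)
    (u : EuclideanSpace ℝ (Fin n) → ℝ) (hu : Measurable u)
    (hB : ∫⁻ z : EuclideanSpace ℝ (Fin n) × EuclideanSpace ℝ (Fin n),
        ENNReal.ofReal (|u z.1 - u z.2| ^ p / ‖z.1 - z.2‖ ^ (2 * n))
        ∂(volume.prod volume) < ⊤)
    (v₀ : EuclideanSpace ℝ (Fin n)) (hv₀ : v₀ ≠ 0)
    (hinv : ∀ t : ℝ, ∀ᵐ x : EuclideanSpace ℝ (Fin n) ∂volume, u (x + t • v₀) = u x) :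
    ∃ c : ℝ, ∀ᵐ x : EuclideanSpace ℝ (Fin n) ∂volume, u x = c := by
  let F : EuclideanSpace ℝ (Fin n) × EuclideanSpace ℝ (Fin n) → ENNReal := fun z =>
    ENNReal.ofReal (|u z.1 - u z.2| ^ p / ‖z.1 - z.2‖ ^ (2 * n))
  have hF : Measurable F := by fun_prop
  have hG : Measurable fun z : EuclideanSpace ℝ (Fin n) × EuclideanSpace ℝ (Fin n) =>
      F (z.1, z.1 + z.2) := by fun_prop
  have hshift : ∫⁻ z, F z ∂(volume.prod volume) = ∫⁻ h, ∫⁻ x, F (x, x + h) := by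
    rw [← (measurePreserving_prod_add volume volume).lintegral_comp hF,
      lintegral_prod_symm _ hG.aemeasurable]
  have hinv₀ : ∀ᵐ x ∂volume, u (x + v₀) = u x := by simpa using hinv 1
  have hzero : ∀ᵐ z ∂(volume.prod volume), F z = 0 := by
    refine (lintegral_eq_zero_iff hF).1 ?_
    change ∫⁻ z, F z ∂(volume.prod volume) < ⊤ at hB
    rw [hshift] at hB ⊢
    refine (lintegral_eq_zero_iff hG.lintegral_prod_left').2 ?_
    filter_upwards [ae_lt_top hG.lintegral_prod_left' hB.ne] with h hh
    refine lintegral_eq_zero_of_ae_translation_invariant v₀ hv₀ ?_ hh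
    filter_upwards [hinv₀,
      (measurePreserving_add_right volume h).quasiMeasurePreserving.ae hinv₀] with x hx hxh
    have hxh' : u (x + v₀ + h) = u (x + h) := by rw [add_right_comm, hxh]
    simp [F, hx, hxh']
  obtain ⟨x, hx⟩ := (Measure.ae_ae_of_ae_prod hzero).exists
  have : Nonempty (Fin n) := ⟨⟨0, hn⟩⟩
  refine ⟨u x, ?_⟩
  filter_upwards [hx, Measure.ae_ne volume x] with y hy hyx
  have hpos : 0 < ‖x - y‖ ^ (2 * n) := pow_pos (norm_pos_iff.2 (sub_ne_zero.2 hyx.symm)) _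
  by_contra hne
  have habs : 0 < |u x - u y| := abs_pos.2 (sub_ne_zero.2 (Ne.symm hne))
  exact (ENNReal.ofReal_pos.2 (div_pos (Real.rpow_pos_of_pos habs p) hpos)).ne' hy
end

section
/- Let n ≥ 1 be an integer, p ∈ [1,∞), and let u : ℝ^n → ℝ be measurable. Let a, b ∈ ℝ^n with a ≠ b, set v₀ = b − a, and assume u is approximately continuous at a and at b. If there exists δ > 0 such that ∫∫_{{(x,x') : ‖x' − x − v₀‖ < δ}} |u(x) − u(x')|^p / ‖x' − x − v₀‖^{n} dx dx' < ∞, then u(a) = u(b). -/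
open MeasureTheory ENNReal

/-- A measurable function `u : ℝ^n → ℝ` is approximately continuous at `a` if for every
`ε > 0` the set `{x : |u(x) − u(a)| < ε}` has Lebesgue density `1` at `a`. -/
def ApproxContinuousAt {n : ℕ} (u : EuclideanSpace ℝ (Fin n) → ℝ)
    (a : EuclideanSpace ℝ (Fin n)) : Prop :=
  ∀ ε : ℝ, 0 < ε → Filter.Tendsto
    (fun r : ℝ =>
      volume {x : EuclideanSpace ℝ (Fin n) | x ∈ Metric.ball a r ∧ |u x - u a| < ε}
        / volume (Metric.ball a r))
    (nhdsWithin 0 (Set.Ioi 0)) (nhds 1)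

/-- The function `‖w‖ ^ (-dim E)` is not integrable near the origin. -/
theorem lintegral_ball_norm_pow_inv_eq_top {E : Type*} [NormedAddCommGroup E] [NormedSpace ℝ E]
    [FiniteDimensional ℝ E] [Nontrivial E] [MeasurableSpace E] [BorelSpace E]
    (μ : Measure E) [μ.IsAddHaarMeasure] {s : ℝ} (hs : 0 < s) :
    ∫⁻ w in Metric.ball (0 : E) s, ENNReal.ofReal ((‖w‖ ^ Module.finrank ℝ E)⁻¹) ∂μ = ⊤ := by
  by_contra h
  have hmeas : Measurable fun w : E => (‖w‖ ^ Module.finrank ℝ E)⁻¹ :=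
    (measurable_norm.pow_const _).inv
  have hint : IntegrableOn (fun w : E => (‖w‖ ^ Module.finrank ℝ E)⁻¹) (Metric.ball 0 s) μ := by
    refine ⟨hmeas.aestronglyMeasurable, ?_⟩
    rw [hasFiniteIntegral_iff_ofReal (.of_forall fun w => by positivity)]
    exact lt_top_iff_ne_top.2 h
  have hint' := (integrableOn_fun_norm_addHaar μ
    (f := fun y : ℝ => (y ^ Module.finrank ℝ E)⁻¹) (r := s)).1 hint
  have hinv : IntegrableOn (fun y : ℝ => y⁻¹) (Set.Ioo 0 s) := by
    refine hint'.congr_fun (fun y hy => ?_) measurableSet_Ioo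
    obtain ⟨m, hm⟩ := Nat.exists_eq_succ_of_ne_zero (Module.finrank_pos (R := ℝ) (M := E)).ne'
    have hy0 : y ≠ 0 := hy.1.ne'
    simp only [hm, Nat.succ_eq_add_one, Nat.add_sub_cancel, smul_eq_mul]
    field_simp
    rw [pow_succ]
  rw [← intervalIntegrable_iff_integrableOn_Ioo_of_le hs.le, intervalIntegrable_inv_iff] at hinv
  rcases hinv with h0 | h0
  · exact hs.ne h0
  · exact h0 Set.left_mem_uIcc

/-- At a point of approximate continuity, every small ball is filled up to any fixed proportion
`c < 1` by the points where the function is close to its value at the centre. -/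
theorem ApproxContinuousAt.eventually_mul_lt_measureReal {n : ℕ}
    {u : EuclideanSpace ℝ (Fin n) → ℝ} {a : EuclideanSpace ℝ (Fin n)}
    (ha : ApproxContinuousAt u a) {ε : ℝ} (hε : 0 < ε) {c : ℝ} (hc : c < 1) :
    ∀ᶠ r in nhdsWithin (0 : ℝ) (Set.Ioi 0),
      c * volume.real (Metric.ball a r) <
        volume.real {x : EuclideanSpace ℝ (Fin n) | x ∈ Metric.ball a r ∧ |u x - u a| < ε} := by
  have hlim := (ENNReal.tendsto_toReal one_ne_top).comp (ha ε hε)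
  rw [ENNReal.toReal_one] at hlim
  filter_upwards [hlim.eventually (lt_mem_nhds hc), self_mem_nhdsWithin] with r hr hr0
  have hpos : 0 < volume.real (Metric.ball a r) :=
    ENNReal.toReal_pos (Metric.measure_ball_pos volume a hr0).ne' measure_ball_lt_top.ne
  rw [Function.comp_apply, ENNReal.toReal_div] at hr
  exact (lt_div_iff₀ hpos).1 hr

/-- Two measurable sets filling most of two balls of the same radius whose centres are close
to each other have an intersection of measure bounded below. -/
theorem exists_pos_forall_le_measureReal_inter {E : Type*} [NormedAddCommGroup E]
    [NormedSpace ℝ E] [FiniteDimensional ℝ E] [MeasurableSpace E] [BorelSpace E]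
    (μ : Measure E) [μ.IsAddHaarMeasure] (a : E) {r : ℝ} (hr : 0 < r) :
    ∃ t > 0, ∀ w : E, ‖w‖ < t → ∀ A B : Set E, MeasurableSet B →
      A ⊆ Metric.ball a r → B ⊆ Metric.ball (a - w) r →
      3 / 4 * μ.real (Metric.ball a r) < μ.real A →
      3 / 4 * μ.real (Metric.ball a r) < μ.real B →
      1 / 4 * μ.real (Metric.ball a r) ≤ μ.real (A ∩ B) := by
  have hcont : Filter.Tendsto (fun c : ℝ => (1 + c) ^ Module.finrank ℝ E)
      (nhdsWithin 0 (Set.Ioi 0)) (nhds 1) := by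
    have h : Continuous fun c : ℝ => (1 + c) ^ Module.finrank ℝ E := by fun_prop
    simpa using (h.tendsto 0).mono_left nhdsWithin_le_nhds
  obtain ⟨c, hc, hc0⟩ := ((hcont.eventually (gt_mem_nhds (by norm_num : (1 : ℝ) < 5 / 4))).and
    self_mem_nhdsWithin).exists
  refine ⟨c * r, by positivity, fun w hw A B hB hA hBs hmA hmB => ?_⟩
  have hAf : μ A ≠ ⊤ := measure_ne_top_of_subset hA measure_ball_lt_top.ne
  have hBf : μ B ≠ ⊤ := measure_ne_top_of_subset hBs measure_ball_lt_top.ne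
  have hsub : A ∪ B ⊆ Metric.ball a ((1 + c) * r) := by
    refine Set.union_subset (hA.trans (Metric.ball_subset_ball (by nlinarith)))
      (hBs.trans (Metric.ball_subset_ball' ?_))
    rw [dist_eq_norm, sub_sub_cancel_left, norm_neg]
    linarith
  have hball : μ.real (Metric.ball a ((1 + c) * r)) =
      (1 + c) ^ Module.finrank ℝ E * μ.real (Metric.ball a r) := by
    rw [measureReal_def, Measure.addHaar_ball_mul_of_pos μ a (by linarith) r, ENNReal.toReal_mul,
      ENNReal.toReal_ofReal (by positivity), measureReal_def, Measure.addHaar_ball_center μ a r]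
  have hunion : μ.real (A ∪ B) ≤ 5 / 4 * μ.real (Metric.ball a r) :=
    (measureReal_mono hsub measure_ball_lt_top.ne).trans
      (hball.trans_le (mul_le_mul_of_nonneg_right hc.le measureReal_nonneg))
  have hadd := measureReal_union_add_inter (s := A) hB hAf hBf
  linarith

/-- Change of variables `x' = x + v + w` in a double integral. -/
theorem lintegral_prod_eq_lintegral_lintegral_add {G : Type*} [AddCommGroup G]
    [MeasurableSpace G] [MeasurableAdd₂ G] (μ : Measure G) [SFinite μ]
    [μ.IsAddLeftInvariant] {f : G × G → ℝ≥0∞} (hf : Measurable f) (v : G) :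
    ∫⁻ z, f z ∂(μ.prod μ) = ∫⁻ w, ∫⁻ x, f (x, x + v + w) ∂μ ∂μ := by
  have hf' : Measurable (Function.uncurry fun x w => f (x, x + v + w)) := by
    unfold Function.uncurry
    fun_prop
  rw [lintegral_prod _ hf.aemeasurable, ← lintegral_lintegral_swap hf'.aemeasurable]
  exact lintegral_congr fun x => (lintegral_add_left_eq_self (fun y => f (x, y)) (x + v)).symm

/-- Let `u : ℝ^n → ℝ` be measurable, `a ≠ b`, `v₀ = b − a`, with `u`
approximately continuous at `a` and at `b`.  If for some `δ > 0` the integral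
`∫∫_{‖x' − x − v₀‖ < δ} |u(x) − u(x')|^p / ‖x' − x − v₀‖^n dx dx'` is finite,
then `u(a) = u(b)`. -/
theorem stmt5 (n : ℕ) (hn : 1 ≤ n) (p : ℝ) (hp : 1 ≤ p)
    (u : EuclideanSpace ℝ (Fin n) → ℝ) (hu : Measurable u)
    (a b : EuclideanSpace ℝ (Fin n)) (hab : a ≠ b)
    (ha : ApproxContinuousAt u a) (hb : ApproxContinuousAt u b)
    (δ : ℝ) (hδ : 0 < δ)
    (hint : ∫⁻ z in {z : EuclideanSpace ℝ (Fin n) × EuclideanSpace ℝ (Fin n) |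
          ‖z.2 - z.1 - (b - a)‖ < δ},
        ENNReal.ofReal (|u z.1 - u z.2| ^ p / ‖z.2 - z.1 - (b - a)‖ ^ n)
        ∂(volume.prod volume) < ⊤) :
    u a = u b := by
  have : Nonempty (Fin n) := ⟨⟨0, hn⟩⟩
  by_contra hne
  obtain ⟨ε, hε, hsep⟩ : ∃ ε > 0, |u a - u b| = 3 * ε :=
    ⟨|u a - u b| / 3, div_pos (abs_pos.2 (sub_ne_zero.2 hne)) three_pos, by ring⟩
  obtain ⟨r, ⟨hra, hrb⟩, hr⟩ := (((ha.eventually_mul_lt_measureReal hε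
    (by norm_num : (3 / 4 : ℝ) < 1)).and (hb.eventually_mul_lt_measureReal hε
    (by norm_num : (3 / 4 : ℝ) < 1))).and self_mem_nhdsWithin).exists
  obtain ⟨t, ht, hinter⟩ := exists_pos_forall_le_measureReal_inter volume a hr
  set A := {x : EuclideanSpace ℝ (Fin n) | x ∈ Metric.ball a r ∧ |u x - u a| < ε}
  set B := {x : EuclideanSpace ℝ (Fin n) | x ∈ Metric.ball b r ∧ |u x - u b| < ε}
  have hAm : MeasurableSet A :=
    measurableSet_ball.inter (measurableSet_lt
      (by fun_prop : Measurable fun x => |u x - u a|) measurable_const)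
  have hBm : MeasurableSet B :=
    measurableSet_ball.inter (measurableSet_lt
      (by fun_prop : Measurable fun x => |u x - u b|) measurable_const)
  set m : ℝ := 1 / 4 * volume.real (Metric.ball a r)
  have hm0 : 0 < m := mul_pos (by norm_num)
    (ENNReal.toReal_pos (Metric.measure_ball_pos volume a hr).ne' measure_ball_lt_top.ne)
  have hlower : ∀ w : EuclideanSpace ℝ (Fin n), ‖w‖ < t →
      ENNReal.ofReal m ≤ volume (A ∩ (fun x => x + (b - a + w)) ⁻¹' B) := by
    intro w hw
    have hvol : volume ((fun x => x + (b - a + w)) ⁻¹' B) = volume B :=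
      measure_preimage_add_right volume _ B
    refine ENNReal.ofReal_le_of_le_toReal (hinter w hw A _ ((measurable_add_const _) hBm)
      (fun x hx => hx.1) (fun x hx => ?_) hra ?_)
    · have hx1 : x + (b - a + w) ∈ Metric.ball b r := hx.1
      rw [Metric.mem_ball, dist_eq_norm] at hx1 ⊢
      convert hx1 using 2
      abel
    · rw [measureReal_def volume (_ ⁻¹' B), hvol, measureReal_def volume (Metric.ball a r),
        Measure.addHaar_ball_center volume a r, ← Measure.addHaar_ball_center volume b r]
      exact hrb
  have hdom : MeasurableSet {z : EuclideanSpace ℝ (Fin n) × EuclideanSpace ℝ (Fin n) |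
      ‖z.2 - z.1 - (b - a)‖ < δ} := measurableSet_lt (by fun_prop) measurable_const
  have hF : Measurable fun z : EuclideanSpace ℝ (Fin n) × EuclideanSpace ℝ (Fin n) =>
      ENNReal.ofReal (|u z.1 - u z.2| ^ p / ‖z.2 - z.1 - (b - a)‖ ^ n) := by fun_prop
  rw [← lintegral_indicator hdom, lintegral_prod_eq_lintegral_lintegral_add volume
    (hF.indicator hdom) (b - a)] at hint
  have hK : ENNReal.ofReal (ε ^ p) * ENNReal.ofReal m ≠ 0 := by
    have := Real.rpow_pos_of_pos hε p
    simp [this, hm0]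
  refine hint.not_ge ?_
  calc (⊤ : ℝ≥0∞)
      = ENNReal.ofReal (ε ^ p) * ENNReal.ofReal m *
          ∫⁻ w in Metric.ball (0 : EuclideanSpace ℝ (Fin n)) (min t δ),
            ENNReal.ofReal ((‖w‖ ^ n)⁻¹) := by
        have h := lintegral_ball_norm_pow_inv_eq_top
          (volume : Measure (EuclideanSpace ℝ (Fin n))) (lt_min ht hδ)
        rw [finrank_euclideanSpace_fin] at h
        rw [h, ENNReal.mul_top hK]
    _ = ∫⁻ w in Metric.ball (0 : EuclideanSpace ℝ (Fin n)) (min t δ),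
          ENNReal.ofReal (ε ^ p) * ENNReal.ofReal m * ENNReal.ofReal ((‖w‖ ^ n)⁻¹) :=
        (lintegral_const_mul _ (by fun_prop)).symm
    _ ≤ ∫⁻ w in Metric.ball (0 : EuclideanSpace ℝ (Fin n)) (min t δ), ∫⁻ x, _ :=
        setLIntegral_mono' measurableSet_ball fun w hw => ?_
    _ ≤ _ := setLIntegral_le_lintegral _ _
  rw [mem_ball_zero_iff, lt_min_iff] at hw
  have hS : MeasurableSet (A ∩ (fun x => x + (b - a + w)) ⁻¹' B) :=
    hAm.inter ((measurable_add_const _) hBm)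
  calc ENNReal.ofReal (ε ^ p) * ENNReal.ofReal m * ENNReal.ofReal ((‖w‖ ^ n)⁻¹)
      = ENNReal.ofReal (ε ^ p / ‖w‖ ^ n) * ENNReal.ofReal m := by
        rw [div_eq_mul_inv, ENNReal.ofReal_mul (p := ε ^ p) (by positivity), mul_right_comm]
    _ ≤ ENNReal.ofReal (ε ^ p / ‖w‖ ^ n) * volume (A ∩ (fun x => x + (b - a + w)) ⁻¹' B) := by
        gcongr
        exact hlower w hw.1
    _ = ∫⁻ _ in A ∩ (fun x => x + (b - a + w)) ⁻¹' B, ENNReal.ofReal (ε ^ p / ‖w‖ ^ n) :=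
        (setLIntegral_const _ _).symm
    _ ≤ ∫⁻ x in A ∩ (fun x => x + (b - a + w)) ⁻¹' B, _ :=
        setLIntegral_mono' hS fun x hx => ?_
    _ ≤ _ := setLIntegral_le_lintegral _ _
  have hcancel : x + (b - a) + w - x - (b - a) = w := by abel
  rw [Set.indicator_of_mem (by simpa only [Set.mem_ofPred_eq, hcancel] using hw.2)]
  simp only [hcancel]
  have hxA : |u x - u a| < ε := hx.1.2
  have hxB : |u (x + (b - a) + w) - u b| < ε := by
    rw [add_assoc]
    exact hx.2.2
  have hfar : ε ≤ |u x - u (x + (b - a) + w)| := by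
    have h1 := abs_sub_le (u a) (u x) (u b)
    have h2 := abs_sub_le (u x) (u (x + (b - a) + w)) (u b)
    rw [abs_sub_comm (u a) (u x)] at h1
    linarith
  gcongr
end

section
/- Let B and C be real Banach spaces, let φ : B → C be a surjective continuous linear map, let (Q,μ) be a measure space and let p ∈ [1,∞). Then for every f ∈ L^p(μ; C) and every λ > 1 there exists g ∈ L^p(μ; B) such that φ(g(x)) = f(x) for μ-almost every x and ‖g(x)‖_B ≤ λ · inf{‖b‖_B : φ(b) = f(x)} for μ-almost every x. -/
open MeasureTheory ENNReal

open Filter Topology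

/-- A strongly measurable function is approximated, with arbitrarily small pointwise relative
error, by functions factoring measurably through `ℕ`. -/
lemma MeasureTheory.StronglyMeasurable.exists_nat_approx {Q C : Type*} [MeasurableSpace Q]
    [NormedAddCommGroup C] {f : Q → C} (hf : StronglyMeasurable f) {ε : ℝ} (hε : 0 < ε) :
    ∃ (e : ℕ → C) (N : Q → ℕ), Measurable N ∧ ∀ x, ‖f x - e (N x)‖ ≤ ε * ‖f x‖ := by
  classical
  obtain ⟨c, hc, hfc⟩ := hf.isSeparable_range
  obtain ⟨e, he⟩ := (hc.insert (0 : C)).exists_eq_range (Set.insert_nonempty _ _)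
  have hex (x : Q) : ∃ k, ‖f x - e k‖ ≤ ε * ‖f x‖ := by
    by_cases h0 : f x = 0
    · obtain ⟨k, hk⟩ : (0 : C) ∈ Set.range e := he ▸ Set.mem_insert _ _
      exact ⟨k, by simp [h0, hk]⟩
    · obtain ⟨y, hy, hxy⟩ := Metric.mem_closure_iff.1 (hfc (Set.mem_range_self x)) (ε * ‖f x‖)
        (mul_pos hε (norm_pos_iff.2 h0))
      obtain ⟨k, rfl⟩ : y ∈ Set.range e := he ▸ Set.mem_insert_of_mem _ hy
      exact ⟨k, by rw [← dist_eq_norm]; exact hxy.le⟩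
  refine ⟨e, fun x => Nat.find (hex x), measurable_find hex fun k => ?_,
    fun x => Nat.find_spec (hex x)⟩
  exact (hf.sub stronglyMeasurable_const).norm.measurableSet_le (hf.norm.const_mul ε)

section Selection

variable {B C : Type*} [NormedAddCommGroup B] [NormedSpace ℝ B]
  [NormedAddCommGroup C] [NormedSpace ℝ C]

lemma sInf_norm_fiber_le (φ : B →L[ℝ] C) {b : B} {c : C} (h : φ b = c) :
    sInf {r : ℝ | ∃ b : B, φ b = c ∧ ‖b‖ = r} ≤ ‖b‖ :=
  csInf_le ⟨0, by rintro _ ⟨b, -, rfl⟩; exact norm_nonneg b⟩ ⟨b, h, rfl⟩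

lemma norm_le_opNorm_mul_sInf_norm_fiber (φ : B →L[ℝ] C) (hφ : Function.Surjective φ) (c : C) :
    ‖c‖ ≤ ‖φ‖ * sInf {r : ℝ | ∃ b : B, φ b = c ∧ ‖b‖ = r} := by
  obtain ⟨b₀, hb₀⟩ := hφ c
  have hne : {r : ℝ | ∃ b : B, φ b = c ∧ ‖b‖ = r}.Nonempty := ⟨_, b₀, hb₀, rfl⟩
  rcases (norm_nonneg φ).eq_or_lt with h | h
  · have := φ.le_opNorm b₀
    rwa [hb₀, ← h, zero_mul, ← zero_mul (sInf _), h] at this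
  · rw [← div_le_iff₀' h]
    refine le_csInf hne ?_
    rintro _ ⟨b, rfl, rfl⟩
    rw [div_le_iff₀' h]
    exact φ.le_opNorm b

lemma exists_preimage_norm_le_mul_sInf (φ : B →L[ℝ] C) (hφ : Function.Surjective φ)
    {r : ℝ} (hr : 1 < r) (c : C) :
    ∃ b, φ b = c ∧ ‖b‖ ≤ r * sInf {r : ℝ | ∃ b : B, φ b = c ∧ ‖b‖ = r} := by
  by_cases hc : c = 0
  · refine ⟨0, by simp [hc], ?_⟩
    rw [norm_zero]
    refine mul_nonneg (by linarith) (Real.sInf_nonneg ?_)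
    rintro _ ⟨b, -, rfl⟩
    exact norm_nonneg b
  · have hm : 0 < sInf {r : ℝ | ∃ b : B, φ b = c ∧ ‖b‖ = r} :=
      pos_of_mul_pos_right ((norm_pos_iff.2 hc).trans_le
        (norm_le_opNorm_mul_sInf_norm_fiber φ hφ c)) (norm_nonneg φ)
    obtain ⟨b₀, hb₀⟩ := hφ c
    obtain ⟨_, ⟨b, hb, rfl⟩, hlt⟩ := exists_lt_of_csInf_lt
      (⟨_, b₀, hb₀, rfl⟩ : {r : ℝ | ∃ b : B, φ b = c ∧ ‖b‖ = r}.Nonempty)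
      (lt_mul_of_one_lt_left hm hr)
    exact ⟨b, hb, hlt.le⟩

/-- Strongly measurable functions lift along a surjective bounded linear map between Banach
spaces, with almost optimal pointwise norm. -/
lemma MeasureTheory.StronglyMeasurable.exists_lift_norm_le [CompleteSpace B] [CompleteSpace C]
    {Q : Type*} [MeasurableSpace Q] (φ : B →L[ℝ] C) (hφ : Function.Surjective φ)
    {f : Q → C} (hf : StronglyMeasurable f) {lam : ℝ} (hlam : 1 < lam) :
    ∃ g : Q → B, StronglyMeasurable g ∧ (∀ x, φ (g x) = f x) ∧
      ∀ x, ‖g x‖ ≤ lam * sInf {r : ℝ | ∃ b : B, φ b = f x ∧ ‖b‖ = r} := by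
  obtain ⟨K, hK, hφK⟩ := φ.exists_preimage_norm_le hφ
  obtain ⟨r, hr, hrlam⟩ : ∃ r : ℝ, 1 < r ∧ r * r < lam :=
    ⟨√((1 + lam) / 2), Real.lt_sqrt_of_sq_lt (by linarith),
      by rw [Real.mul_self_sqrt (by linarith)]; linarith⟩
  have hr0 : 0 < r := by linarith
  choose τ hτ hτm using exists_preimage_norm_le_mul_sInf φ hφ hr
  have hτb {b : B} {c : C} (h : φ b = c) : ‖τ c‖ ≤ r * ‖b‖ :=
    (hτm c).trans (mul_le_mul_of_nonneg_left (sInf_norm_fiber_le φ h) hr0.le)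
  have hτK (c : C) : ‖τ c‖ ≤ r * (K * ‖c‖) := by
    obtain ⟨b, hb, hbK⟩ := hφK c
    exact (hτb hb).trans (mul_le_mul_of_nonneg_left hbK hr0.le)
  obtain ⟨ε, hε, hεlam⟩ : ∃ ε > 0, 5 * r * K * ‖φ‖ * ε ≤ lam - r * r := by
    have hpos : 0 < 5 * r * K * ‖φ‖ + 1 := by positivity
    refine ⟨(lam - r * r) / (5 * r * K * ‖φ‖ + 1), div_pos (by linarith) hpos, ?_⟩
    rw [mul_div_assoc', div_le_iff₀ hpos]
    nlinarith
  choose e N hN hfe using fun n : ℕ => hf.exists_nat_approx (ε := ε / 2 ^ n) (by positivity)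
  let h (n : ℕ) (x : Q) : C := e n (N n x)
  let d (n : ℕ) (x : Q) : B := τ (h (n + 1) x - h n x)
  have hd (n : ℕ) : StronglyMeasurable (d n) :=
    (StronglyMeasurable.of_discrete
      (f := fun k : ℕ × ℕ => τ (e (n + 1) k.1 - e n k.2))).comp_measurable
        ((hN (n + 1)).prodMk (hN n))
  have hτh : StronglyMeasurable fun x => τ (h 0 x) :=
    (StronglyMeasurable.of_discrete (f := fun k : ℕ => τ (e 0 k))).comp_measurable (hN 0)
  have hd_le (n : ℕ) (x : Q) : ‖d n x‖ ≤ 4 * r * K * ε * ‖f x‖ / 2 / 2 ^ n := by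
    have h1 : ‖h (n + 1) x - h n x‖ ≤ 2 * (ε / 2 ^ n * ‖f x‖) := by
      have hle : ε / 2 ^ (n + 1) * ‖f x‖ ≤ ε / 2 ^ n * ‖f x‖ := by
        gcongr
        · norm_num
        · simp
      calc ‖h (n + 1) x - h n x‖ = ‖(f x - h n x) - (f x - h (n + 1) x)‖ := by congr 1; abel
        _ ≤ ‖f x - h n x‖ + ‖f x - h (n + 1) x‖ := norm_sub_le _ _
        _ ≤ 2 * (ε / 2 ^ n * ‖f x‖) := by linarith [hfe n x, hfe (n + 1) x]
    calc ‖d n x‖ ≤ r * (K * (2 * (ε / 2 ^ n * ‖f x‖))) := (hτK _).trans (by gcongr)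
      _ = _ := by ring
  have hsum (x : Q) : Summable fun n => d n x :=
    .of_norm_bounded (hasSum_geometric_two' _).summable (hd_le · x)
  have hlim (x : Q) : Tendsto (fun n => h n x) atTop (𝓝 (f x)) := by
    have h0 : Tendsto (fun n : ℕ => ε * ‖f x‖ / 2 / 2 ^ n * 2) atTop (𝓝 0) := by
      simpa using (hasSum_geometric_two' (ε * ‖f x‖)).summable.tendsto_atTop_zero.mul_const 2
    rw [tendsto_iff_norm_sub_tendsto_zero]
    refine squeeze_zero (fun _ => norm_nonneg _) (fun n => ?_) h0
    rw [norm_sub_rev]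
    exact (hfe n x).trans_eq (by ring)
  refine ⟨fun x => τ (h 0 x) + ∑' n, d n x, hτh.add ?_, fun x => ?_, fun x => ?_⟩
  · exact stronglyMeasurable_of_tendsto atTop
      (fun n => Finset.stronglyMeasurable_fun_sum (Finset.range n) fun k _ => hd k)
      (tendsto_pi_nhds.2 fun x => (hsum x).hasSum.tendsto_sum_nat)
  · have h1 := (φ.hasSum (hsum x).hasSum).tendsto_sum_nat
    simp only [d, hτ, Finset.sum_range_sub (fun n => h n x)] at h1
    rw [map_add, hτ, tendsto_nhds_unique h1 ((hlim x).sub_const (h 0 x)), add_sub_cancel]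
  · set m := sInf {r : ℝ | ∃ b : B, φ b = f x ∧ ‖b‖ = r}
    have hm0 : 0 ≤ m := Real.sInf_nonneg (by rintro _ ⟨b, -, rfl⟩; exact norm_nonneg b)
    have htail := tsum_of_norm_bounded (hasSum_geometric_two' _) (hd_le · x)
    obtain ⟨b, hb, hbK⟩ := hφK (f x - h 0 x)
    have hhead : ‖τ (h 0 x)‖ ≤ r * (r * m + K * (ε * ‖f x‖)) := by
      have h0 : ‖f x - h 0 x‖ ≤ ε * ‖f x‖ := by simpa using hfe 0 x
      refine (hτb (b := τ (f x) - b) (by simp [hτ, hb])).trans ?_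
      gcongr
      refine (norm_sub_le _ _).trans (add_le_add (hτm _) (hbK.trans ?_))
      gcongr
    have hfm : ‖f x‖ ≤ ‖φ‖ * m := norm_le_opNorm_mul_sInf_norm_fiber φ hφ (f x)
    calc ‖τ (h 0 x) + ∑' n, d n x‖
        ≤ r * (r * m + K * (ε * ‖f x‖)) + 4 * r * K * ε * ‖f x‖ := norm_add_le_of_le hhead htail
      _ = r * r * m + 5 * r * K * ε * ‖f x‖ := by ring
      _ ≤ r * r * m + 5 * r * K * ε * (‖φ‖ * m) := by gcongr
      _ = (r * r + 5 * r * K * ‖φ‖ * ε) * m := by ring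
      _ ≤ lam * m := by gcongr; linarith

end Selection

/-- Let `φ : B → C` be a surjective continuous linear map between Banach
spaces, `(Q,μ)` a measure space, `p ∈ [1,∞)`.  Then for every `f ∈ L^p(μ; C)` and every
`λ > 1` there is `g ∈ L^p(μ; B)` with `φ(g(x)) = f(x)` a.e. and
`‖g(x)‖ ≤ λ · inf{‖b‖ : φ(b) = f(x)}` a.e. -/
theorem stmt9 {B C : Type*}
    [NormedAddCommGroup B] [NormedSpace ℝ B] [CompleteSpace B]
    [NormedAddCommGroup C] [NormedSpace ℝ C] [CompleteSpace C]
    (φ : B →L[ℝ] C) (hφ : Function.Surjective φ)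
    {Q : Type*} [MeasurableSpace Q] (μ : Measure Q)
    (p : ℝ≥0∞) (hp : 1 ≤ p) (hp' : p ≠ ⊤) :
    haveI : Fact (1 ≤ p) := ⟨hp⟩
    ∀ (f : Lp C p μ) (lam : ℝ), 1 < lam →
      ∃ g : Lp B p μ, (∀ᵐ x ∂μ, φ (g x) = f x) ∧
        ∀ᵐ x ∂μ, ‖g x‖ ≤ lam * sInf {r : ℝ | ∃ b : B, φ b = f x ∧ ‖b‖ = r} := by
  intro f lam hlam
  obtain ⟨K, hK, hφK⟩ := φ.exists_preimage_norm_le hφ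
  obtain ⟨g, hg, hφg, hgle⟩ := (Lp.stronglyMeasurable f).exists_lift_norm_le φ hφ hlam
  have hgK (x : Q) : ‖g x‖ ≤ lam * K * ‖f x‖ := by
    obtain ⟨b, hb, hbK⟩ := hφK (f x)
    rw [mul_assoc]
    exact (hgle x).trans (mul_le_mul_of_nonneg_left ((sInf_norm_fiber_le φ hb).trans hbK)
      (by linarith))
  have hgp : MemLp g p μ :=
    (Lp.memLp f).of_le_mul hg.aestronglyMeasurable (Eventually.of_forall hgK)
  refine ⟨hgp.toLp g, ?_, ?_⟩
  · filter_upwards [hgp.coeFn_toLp] with x hx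
    rw [hx, hφg]
  · filter_upwards [hgp.coeFn_toLp] with x hx
    rw [hx]
    exact hgle x
end
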